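/- Fix constants c̃₀ ∈ (0,1) and c̃₁ > 1. Then there exist a constant c > 0 and α₀ such that for all α ≥ α₀ the following holds: if u is a semistable solution of problem (P_{α,λ*(α)}) and, setting a := u(1/√α), the implication [f(a + t) ≥ c̃₁ f(a) ⟹ (1 − c̃₀)(f(a + t) − f(a)) f'(a + t) ≥ ∫₀^t f'(a + s)² ds] holds for every t ≥ 0, then u(0) ≤ a + c f(a)/log α. -/

import Mathlib

open Set MeasureTheory Filter

/-- The standing data and assumptions of the Gelfand-type problem for
auto-ignition of a free round turbulent jet:
`f : [0,∞) → (0,∞)` is `C¹`, convex, non-decreasing with `K = ∫₀^∞ ds / f s < ∞`;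
`φ, ψ : [0,1] → [0,∞)` are non-increasing Lipschitz with `φ 0 = ψ 0 = 1`,
`φ > 0` on `[0,1)`, and `M s = max_{r ∈ [0,s]} ψ r / φ r` is integrable on `(0,1)`. -/
structure GelfandData where
  f : ℝ → ℝ
  phi : ℝ → ℝ
  psi : ℝ → ℝ
  M : ℝ → ℝ
  K : ℝ
  f_pos : ∀ s, 0 ≤ s → 0 < f s
  f_smooth : ContDiffOn ℝ 1 f (Ici 0)
  f_convex : ConvexOn ℝ (Ici 0) f
  f_mono : MonotoneOn f (Ici 0)
  f_int : IntegrableOn (fun s => 1 / f s) (Ioi 0)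
  K_def : K = ∫ s in Ioi (0:ℝ), 1 / f s
  phi_nonneg : ∀ r ∈ Icc (0:ℝ) 1, 0 ≤ phi r
  psi_nonneg : ∀ r ∈ Icc (0:ℝ) 1, 0 ≤ psi r
  phi_anti : AntitoneOn phi (Icc 0 1)
  psi_anti : AntitoneOn psi (Icc 0 1)
  phi_lip : ∃ L, LipschitzOnWith L phi (Icc 0 1)
  psi_lip : ∃ L, LipschitzOnWith L psi (Icc 0 1)
  phi_zero : phi 0 = 1
  psi_zero : psi 0 = 1
  phi_pos : ∀ r ∈ Ico (0:ℝ) 1, 0 < phi r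
  M_def : ∀ s ∈ Ico (0:ℝ) 1, IsGreatest ((fun r => psi r / phi r) '' Icc 0 s) (M s)
  M_int : IntegrableOn M (Ioo 0 1)

/-- `u` is a (classical, radial) solution of problem `(P_{α,λ})`:
`u ∈ C²((0,1)) ∩ C¹([0,1])`, `u > 0` on `[0,1)`, `u'(0) = 0`, `u 1 = 0`, and
`-u'' - (1/r + α r φ(r)) u' = λ ψ(r) f(u(r))` on `(0,1)`. -/
def IsSolution (D : GelfandData) (α lam : ℝ) (u : ℝ → ℝ) : Prop :=
  ContDiffOn ℝ 1 u (Icc 0 1) ∧ ContDiffOn ℝ 2 u (Ioo 0 1) ∧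
  (∀ r ∈ Ico (0:ℝ) 1, 0 < u r) ∧
  derivWithin u (Icc 0 1) 0 = 0 ∧ u 1 = 0 ∧
  ∀ r ∈ Ioo (0:ℝ) 1,
    -(derivWithin (derivWithin u (Icc 0 1)) (Ioo 0 1) r)
      - (1 / r + α * r * D.phi r) * derivWithin u (Icc 0 1) r
      = lam * D.psi r * D.f (u r)

/-- The set of `λ > 0` for which problem `(P_{α,λ})` admits a solution. -/
def solvableSet (D : GelfandData) (α : ℝ) : Set ℝ :=
  {lam | 0 < lam ∧ ∃ u, IsSolution D α lam u}

/-- The extremal Frank-Kamenetskii parameter `λ*(α)`. -/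
noncomputable def lamStar (D : GelfandData) (α : ℝ) : ℝ := sSup (solvableSet D α)

/-- The weight `μ(r) = exp(α ∫₀^r s φ(s) ds)`. -/
noncomputable def muW (D : GelfandData) (α r : ℝ) : ℝ :=
  Real.exp (α * ∫ s in (0:ℝ)..r, s * D.phi s)

/-- `u` is a semistable solution: for every `C¹` test function `η` with `η 1 = 0`,
`∫₀¹ η'^2 μ r dr ≥ λ ∫₀¹ ψ f'(u) η² μ r dr`. -/
def IsSemistable (D : GelfandData) (α lam : ℝ) (u : ℝ → ℝ) : Prop :=
  ∀ η : ℝ → ℝ, ContDiff ℝ 1 η → η 1 = 0 →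
    lam * ∫ r in Ioo (0:ℝ) 1,
        D.psi r * derivWithin D.f (Ici 0) (u r) * (η r) ^ 2 * muW D α r * r
      ≤ ∫ r in Ioo (0:ℝ) 1, (deriv η r) ^ 2 * muW D α r * r

lemma mono_Icc {g g' : ℝ → ℝ} {a b : ℝ} (hc : ContinuousOn g (Icc a b))
    (hd : ∀ x ∈ Ioo a b, HasDerivAt g (g' x) x) (h0 : ∀ x ∈ Ioo a b, 0 ≤ g' x) :
    MonotoneOn g (Icc a b) := by
  apply monotoneOn_of_hasDerivWithinAt_nonneg (convex_Icc a b) hc (f' := g')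
  · intro x hx; rw [interior_Icc] at *; exact (hd x hx).hasDerivWithinAt
  · intro x hx; rw [interior_Icc] at hx; exact h0 x hx

lemma prim_deriv {g : ℝ → ℝ} {p q c x : ℝ} (hg : ContinuousOn g (Icc p q))
    (hc : c ∈ Icc p q) (hx : x ∈ Ioo p q) :
    HasDerivAt (fun y => ∫ t in c..y, g t) (g x) x := by
  apply intervalIntegral.integral_hasDerivAt_right
  · apply ContinuousOn.intervalIntegrable
    exact hg.mono (uIcc_subset_Icc hc (Ioo_subset_Icc_self hx))
  · exact (hg.mono Ioo_subset_Icc_self).stronglyMeasurableAtFilter isOpen_Ioo _ hx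
  · exact hg.continuousAt (Icc_mem_nhds hx.1 hx.2)

lemma prim_cont {g : ℝ → ℝ} {p q : ℝ} (hpq : p ≤ q) (hg : ContinuousOn g (Icc p q)) :
    ContinuousOn (fun y => ∫ t in p..y, g t) (Icc p q) := by
  have := intervalIntegral.continuousOn_primitive_interval (a := p) (b := q) (f := g)
    (μ := volume) (by rw [uIcc_of_le hpq]; exact hg.integrableOn_Icc)
  rwa [uIcc_of_le hpq] at this

lemma ii_of {g : ℝ → ℝ} {p q a b : ℝ} (hg : ContinuousOn g (Icc p q))
    (ha : a ∈ Icc p q) (hb : b ∈ Icc p q) : IntervalIntegrable g volume a b :=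
  (hg.mono (uIcc_subset_Icc ha hb)).intervalIntegrable

section
variable (D : GelfandData)

lemma phi_cont : ContinuousOn D.phi (Icc 0 1) := by
  obtain ⟨L, hL⟩ := D.phi_lip; exact hL.continuousOn
lemma psi_cont : ContinuousOn D.psi (Icc 0 1) := by
  obtain ⟨L, hL⟩ := D.psi_lip; exact hL.continuousOn
lemma phi_le_one {r : ℝ} (hr : r ∈ Icc (0:ℝ) 1) : D.phi r ≤ 1 := by
  rw [← D.phi_zero]; exact D.phi_anti ⟨le_rfl, zero_le_one⟩ hr hr.1
lemma psi_le_one {r : ℝ} (hr : r ∈ Icc (0:ℝ) 1) : D.psi r ≤ 1 := by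
  rw [← D.psi_zero]; exact D.psi_anti ⟨le_rfl, zero_le_one⟩ hr hr.1

lemma sphi_cont : ContinuousOn (fun s => s * D.phi s) (Icc 0 1) :=
  continuousOn_id.mul (phi_cont D)

lemma mu_cont (α : ℝ) : ContinuousOn (muW D α) (Icc 0 1) := by
  unfold muW
  exact (continuousOn_const.mul (prim_cont zero_le_one (sphi_cont D))).rexp

lemma mu_deriv (α : ℝ) {r : ℝ} (hr : r ∈ Ioo (0:ℝ) 1) :
    HasDerivAt (muW D α) (muW D α r * (α * (r * D.phi r))) r := by
  unfold muW
  exact ((prim_deriv (sphi_cont D) ⟨le_rfl, zero_le_one⟩ hr).const_mul α).exp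

lemma mu_pos (α r : ℝ) : 0 < muW D α r := Real.exp_pos _

lemma mu_ge_one {α r : ℝ} (hα : 0 ≤ α) (hr : r ∈ Icc (0:ℝ) 1) : 1 ≤ muW D α r := by
  unfold muW
  apply Real.one_le_exp
  apply mul_nonneg hα
  apply intervalIntegral.integral_nonneg hr.1
  intro s hs
  exact mul_nonneg hs.1 (D.phi_nonneg s ⟨hs.1, hs.2.trans hr.2⟩)

lemma mu_le {α r : ℝ} (hα : 0 ≤ α) (hr : r ∈ Icc (0:ℝ) 1) (h : α * r ^ 2 ≤ 1) :
    muW D α r ≤ 2 := by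
  have h1 : (∫ s in (0:ℝ)..r, s * D.phi s) ≤ ∫ s in (0:ℝ)..r, s := by
    apply intervalIntegral.integral_mono_on hr.1
    · exact ii_of (sphi_cont D) ⟨le_rfl, zero_le_one⟩ hr
    · exact continuous_id.intervalIntegrable _ _
    · intro s hs
      have := phi_le_one D (r := s) ⟨hs.1, hs.2.trans hr.2⟩
      nlinarith [hs.1]
  rw [integral_id] at h1
  have h2 : muW D α r ≤ Real.exp (1/2) := by
    unfold muW
    apply Real.exp_le_exp.2
    nlinarith
  have h3 : Real.exp (1/2) ≤ 2 := by
    have : Real.exp (1/2) ^ 2 = Real.exp 1 := by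
      rw [← Real.exp_nat_mul]; norm_num
    nlinarith [Real.exp_one_lt_d9, Real.exp_pos (1/2)]
  linarith

lemma mu_ge {α r : ℝ} (hα : 0 ≤ α) (hr : r ∈ Icc (0:ℝ) 1) (h : 1 ≤ α * r ^ 2)
    (hphi : ∀ s ∈ Icc 0 r, 1/2 ≤ D.phi s) :
    5/4 ≤ muW D α r := by
  have h1 : (∫ s in (0:ℝ)..r, s * (1/2)) ≤ ∫ s in (0:ℝ)..r, s * D.phi s := by
    apply intervalIntegral.integral_mono_on hr.1
    · exact (continuous_id.mul continuous_const).intervalIntegrable _ _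
    · exact ii_of (sphi_cont D) ⟨le_rfl, zero_le_one⟩ hr
    · intro s hs
      have := hphi s hs
      nlinarith [hs.1]
  rw [intervalIntegral.integral_mul_const, integral_id] at h1
  have h2 : Real.exp (1/4) ≤ muW D α r := by
    unfold muW
    apply Real.exp_le_exp.2
    nlinarith
  have := Real.add_one_le_exp (1/4)
  linarith

lemma f_cont : ContinuousOn D.f (Ici 0) := D.f_smooth.continuousOn
lemma fp_cont : ContinuousOn (derivWithin D.f (Ici 0)) (Ici 0) :=
  D.f_smooth.continuousOn_derivWithin (uniqueDiffOn_Ici 0) le_rfl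
lemma f_deriv {x : ℝ} (hx : 0 < x) : HasDerivAt D.f (derivWithin D.f (Ici 0) x) x :=
  ((D.f_smooth.differentiableOn one_ne_zero) x hx.le).hasDerivWithinAt.hasDerivAt
    (Ici_mem_nhds hx)
lemma fp_mono : MonotoneOn (derivWithin D.f (Ici 0)) (Ici 0) :=
  D.f_convex.monotoneOn_derivWithin (D.f_smooth.differentiableOn one_ne_zero)
lemma fp_nonneg (x : ℝ) : 0 ≤ derivWithin D.f (Ici 0) x :=
  D.f_mono.derivWithin_nonneg

lemma u_deriv {α lam : ℝ} {u : ℝ → ℝ} (h : IsSolution D α lam u) {r : ℝ}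
    (hr : r ∈ Ioo (0:ℝ) 1) : HasDerivAt u (derivWithin u (Icc 0 1) r) r :=
  ((h.1.differentiableOn one_ne_zero) r (Ioo_subset_Icc_self hr)).hasDerivWithinAt.hasDerivAt
    (Icc_mem_nhds hr.1 hr.2)

lemma v_cont {α lam : ℝ} {u : ℝ → ℝ} (h : IsSolution D α lam u) :
    ContinuousOn (derivWithin u (Icc 0 1)) (Icc 0 1) :=
  h.1.continuousOn_derivWithin (uniqueDiffOn_Icc zero_lt_one) le_rfl

lemma u_nonneg {α lam : ℝ} {u : ℝ → ℝ} (h : IsSolution D α lam u) {r : ℝ}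
    (hr : r ∈ Icc (0:ℝ) 1) : 0 ≤ u r := by
  rcases hr.2.lt_or_eq with h1 | h1
  · exact (h.2.2.1 r ⟨hr.1, h1⟩).le
  · rw [h1, h.2.2.2.2.1]

lemma v_deriv {α lam : ℝ} {u : ℝ → ℝ} (h : IsSolution D α lam u) {r : ℝ}
    (hr : r ∈ Ioo (0:ℝ) 1) : HasDerivAt (derivWithin u (Icc 0 1))
      (-(lam * D.psi r * D.f (u r)) - (1 / r + α * r * D.phi r) * derivWithin u (Icc 0 1) r) r := by
  have h2 : DifferentiableOn ℝ (deriv u) (Ioo 0 1) :=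
    (h.2.1.deriv_of_isOpen (m := 1) isOpen_Ioo (by norm_num)).differentiableOn one_ne_zero
  have heq : ∀ x ∈ Ioo (0:ℝ) 1, derivWithin u (Icc 0 1) x = deriv u x :=
    fun x hx => (u_deriv D h hx).deriv.symm
  have h3 : DifferentiableOn ℝ (derivWithin u (Icc 0 1)) (Ioo 0 1) := h2.congr heq
  have h4 := (h3 r hr).hasDerivWithinAt.hasDerivAt (Ioo_mem_nhds hr.1 hr.2)
  have h5 := h.2.2.2.2.2 r hr
  exact h4.congr_deriv (by linarith)

/-- the flux -/
noncomputable def flux (α : ℝ) (u : ℝ → ℝ) (r : ℝ) : ℝ :=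
  -(r * muW D α r * derivWithin u (Icc 0 1) r)

lemma flux_cont {α lam : ℝ} {u : ℝ → ℝ} (h : IsSolution D α lam u) :
    ContinuousOn (flux D α u) (Icc 0 1) :=
  ((continuousOn_id.mul (mu_cont D α)).mul (v_cont D h)).neg

lemma flux_deriv {α lam : ℝ} {u : ℝ → ℝ} (h : IsSolution D α lam u) {r : ℝ}
    (hr : r ∈ Ioo (0:ℝ) 1) :
    HasDerivAt (flux D α u) (lam * (r * muW D α r * D.psi r * D.f (u r))) r := by
  have h1 := (((hasDerivAt_id r).mul (mu_deriv D α hr)).mul (v_deriv D h hr)).neg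
  have hr0 : r ≠ 0 := hr.1.ne'
  refine HasDerivAt.congr_deriv (f := flux D α u) h1 ?_
  simp only [id, Pi.mul_apply]
  field_simp
  ring

lemma fu_cont {α lam : ℝ} {u : ℝ → ℝ} (h : IsSolution D α lam u) :
    ContinuousOn (fun r => D.f (u r)) (Icc 0 1) :=
  (f_cont D).comp h.1.continuousOn (fun _ hr => u_nonneg D h hr)

lemma fpu_cont {α lam : ℝ} {u : ℝ → ℝ} (h : IsSolution D α lam u) :
    ContinuousOn (fun r => derivWithin D.f (Ici 0) (u r)) (Icc 0 1) :=
  (fp_cont D).comp h.1.continuousOn (fun _ hr => u_nonneg D h hr)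

lemma fu_deriv {α lam : ℝ} {u : ℝ → ℝ} (h : IsSolution D α lam u) {r : ℝ}
    (hr : r ∈ Ioo (0:ℝ) 1) : HasDerivAt (fun r => D.f (u r))
      (derivWithin D.f (Ici 0) (u r) * derivWithin u (Icc 0 1) r) r :=
  (f_deriv D (h.2.2.1 r ⟨hr.1.le, hr.2⟩)).comp r (u_deriv D h hr)

lemma fu_pos {α lam : ℝ} {u : ℝ → ℝ} (h : IsSolution D α lam u) {r : ℝ}
    (hr : r ∈ Icc (0:ℝ) 1) : 0 < D.f (u r) := D.f_pos _ (u_nonneg D h hr)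

lemma flux_zero (α : ℝ) (u : ℝ → ℝ) : flux D α u 0 = 0 := by simp [flux]

lemma flux_nonneg {α lam : ℝ} {u : ℝ → ℝ} (hl : 0 ≤ lam) (h : IsSolution D α lam u) {r : ℝ}
    (hr : r ∈ Icc (0:ℝ) 1) : 0 ≤ flux D α u r := by
  rw [← flux_zero D α u]
  refine mono_Icc (flux_cont D h) (fun x hx => flux_deriv D h hx) ?_ ⟨le_rfl, zero_le_one⟩ hr hr.1
  intro x hx
  have hx' := Ioo_subset_Icc_self hx
  have := mu_pos D α x
  have := D.psi_nonneg x hx'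
  have := fu_pos D h hx'
  have := hx.1
  positivity

lemma v_nonpos {α lam : ℝ} {u : ℝ → ℝ} (hl : 0 ≤ lam) (h : IsSolution D α lam u) {r : ℝ}
    (hr : r ∈ Icc (0:ℝ) 1) : derivWithin u (Icc 0 1) r ≤ 0 := by
  rcases hr.1.eq_or_lt with h0 | h0
  · rw [← h0, h.2.2.2.1]
  · have h1 := flux_nonneg D hl h hr
    have h2 := mul_pos h0 (mu_pos D α r)
    unfold flux at h1
    by_contra hc
    push Not at hc
    nlinarith [mul_pos h2 hc]

lemma u_anti {α lam : ℝ} {u : ℝ → ℝ} (hl : 0 ≤ lam) (h : IsSolution D α lam u) :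
    AntitoneOn u (Icc 0 1) := by
  have := mono_Icc (a := 0) (b := 1) (g := fun r => - u r) h.1.continuousOn.neg
    (fun x hx => (u_deriv D h hx).neg)
    (fun x hx => by have := v_nonpos D hl h (Ioo_subset_Icc_self hx); linarith)
  intro x hx y hy hxy
  have := this hx hy hxy
  simpa using this

lemma fu_anti {α lam : ℝ} {u : ℝ → ℝ} (hl : 0 ≤ lam) (h : IsSolution D α lam u) :
    AntitoneOn (fun r => D.f (u r)) (Icc 0 1) := fun _ hx _ hy hxy =>
  D.f_mono (u_nonneg D h hy) (u_nonneg D h hx) (u_anti D hl h hx hy hxy)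

lemma exists_delta : ∃ δ ∈ Ioo (0:ℝ) 1, ∀ s ∈ Icc 0 δ, 1/2 ≤ D.phi s ∧ 1/2 ≤ D.psi s := by
  have h0 : (0:ℝ) ∈ Icc (0:ℝ) 1 := ⟨le_rfl, zero_le_one⟩
  have h1 : ∀ᶠ s in nhdsWithin 0 (Icc (0:ℝ) 1), 1/2 < D.phi s :=
    (phi_cont D 0 h0).eventually (lt_mem_nhds (by rw [D.phi_zero]; norm_num))
  have h2 : ∀ᶠ s in nhdsWithin 0 (Icc (0:ℝ) 1), 1/2 < D.psi s :=
    (psi_cont D 0 h0).eventually (lt_mem_nhds (by rw [D.psi_zero]; norm_num))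
  obtain ⟨ε, hε, hh⟩ := Metric.eventually_nhds_iff.1 (eventually_nhdsWithin_iff.1 (h1.and h2))
  refine ⟨min (ε/2) (1/2), ⟨by positivity, (min_le_right _ _).trans_lt (by norm_num)⟩, ?_⟩
  intro s hs
  have a1 : s ≤ ε/2 := hs.2.trans (min_le_left _ _)
  have a2 : s ≤ 1/2 := hs.2.trans (min_le_right _ _)
  have := hh (y := s) (by rw [Real.dist_eq, sub_zero, abs_of_nonneg hs.1]; linarith)
    ⟨hs.1, by linarith⟩
  exact ⟨this.1.le, this.2.le⟩

/-- Upper bound of lambda. -/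
lemma lam_bound : ∃ C ≥ (0:ℝ), ∃ α₀ > (1:ℝ), ∀ α ≥ α₀, ∀ lam ≥ (0:ℝ), ∀ u,
    IsSolution D α lam u → lam * Real.log α ≤ C * α := by
  obtain ⟨δ, hδ, hd⟩ := exists_delta D
  have hKn : 0 ≤ ∫ s in Ioi (0:ℝ), 1 / D.f s :=
    setIntegral_nonneg measurableSet_Ioi
      (fun s hs => (one_div_pos.2 (D.f_pos s (le_of_lt hs))).le)
  refine ⟨40 * ∫ s in Ioi (0:ℝ), 1 / D.f s, by positivity, (δ⁻¹) ^ 4,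
    one_lt_pow₀ (one_lt_inv₀ hδ.1 |>.2 hδ.2) (by norm_num), ?_⟩
  intro α hα lam hl u h
  have hδ4 : 1 < (δ⁻¹) ^ 4 := one_lt_pow₀ (one_lt_inv₀ hδ.1 |>.2 hδ.2) (by norm_num)
  have hα1 : 1 < α := lt_of_lt_of_le hδ4 hα
  have hα0 : 0 < α := by linarith
  have hlog : -(4 * Real.log δ) ≤ Real.log α := by
    have := Real.log_le_log (by linarith) hα
    rw [Real.log_pow, Real.log_inv] at this
    push_cast at this; linarith
  have hlogδ : Real.log δ < 0 := Real.log_neg hδ.1 hδ.2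
  set r0 := 1 / Real.sqrt α with hr0
  have hsq : 0 < Real.sqrt α := Real.sqrt_pos.2 hα0
  have hr0p : 0 < r0 := by positivity
  have hlr0 : Real.log r0 = -(Real.log α / 2) := by
    rw [hr0, one_div, Real.log_inv, Real.log_sqrt hα0.le]
  have hr0δ : r0 ≤ δ := by
    rw [← Real.log_le_log_iff hr0p hδ.1, hlr0]; linarith
  have hr0sq : α * r0 ^ 2 = 1 := by
    rw [hr0, div_pow, Real.sq_sqrt hα0.le]; field_simp
  -- flux lower bound
  have key : ∀ r ∈ Ioo r0 δ, lam * D.f (u r) / (10 * α) * muW D α r ≤ flux D α u r := by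
    intro r hr
    have hrI : r ∈ Ioo (0:ℝ) 1 := ⟨hr0p.trans hr.1, hr.2.trans hδ.2⟩
    have hsub : Icc 0 r ⊆ Icc (0:ℝ) 1 := Icc_subset_Icc_right hrI.2.le
    have hF := fu_pos D h (Ioo_subset_Icc_self hrI)
    have hm := mono_Icc (a := 0) (b := r)
      (g := fun s => flux D α u s - lam * D.f (u r) / (2 * α) * muW D α s)
      (g' := fun s => lam * (s * muW D α s * D.psi s * D.f (u s))
        - lam * D.f (u r) / (2 * α) * (muW D α s * (α * (s * D.phi s))))
      (((flux_cont D h).mono hsub).sub (continuousOn_const.mul ((mu_cont D α).mono hsub)))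
      (fun s hs => (flux_deriv D h ⟨hs.1, hs.2.trans hrI.2⟩).sub
        ((mu_deriv D α ⟨hs.1, hs.2.trans hrI.2⟩).const_mul _))
      (by
        intro s hs
        have hsI : s ∈ Icc (0:ℝ) 1 := hsub (Ioo_subset_Icc_self hs)
        have e1 : D.f (u r) ≤ D.f (u s) :=
          fu_anti D hl h hsI (Ioo_subset_Icc_self hrI) hs.2.le
        have e2 := (hd s ⟨hs.1.le, hs.2.le.trans hr.2.le⟩).2
        have e3 := phi_le_one D hsI
        have e4 := mu_pos D α s
        have e5 : lam * (s * muW D α s * D.psi s * D.f (u s))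
          - lam * D.f (u r) / (2 * α) * (muW D α s * (α * (s * D.phi s)))
          = lam * s * muW D α s * (D.psi s * D.f (u s) - D.f (u r) * D.phi s / 2) := by
          field_simp
        rw [e5]
        have hs1 := hs.1
        refine mul_nonneg (by positivity) ?_
        nlinarith)
    have hm2 := hm ⟨le_rfl, hrI.1.le⟩ ⟨hrI.1.le, le_rfl⟩ hrI.1.le
    have hmu0 : muW D α 0 = 1 := by simp [muW]
    simp only [flux_zero, hmu0] at hm2
    have hmu := mu_ge D hα0.le (Ioo_subset_Icc_self hrI)
      (by rw [← hr0sq]; have := hr.1; gcongr)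
      (fun s hs => (hd s ⟨hs.1, hs.2.trans hr.2.le⟩).1)
    have hc : 0 ≤ lam * D.f (u r) / (10 * α) := by positivity
    have : lam * D.f (u r) / (2 * α) = 5 * (lam * D.f (u r) / (10 * α)) := by
      field_simp; ring
    rw [this] at hm2
    nlinarith
  -- integrate
  have hcf : ContinuousOn (fun s => 1 / D.f s) (Ici 0) :=
    continuousOn_const.div (f_cont D) (fun x hx => (D.f_pos x hx).ne')
  have hII : ∀ x, 0 < x → HasDerivAt (fun y => ∫ t in (0:ℝ)..y, 1 / D.f t) (1 / D.f x) x := by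
    intro x hx
    exact prim_deriv (g := fun s => 1 / D.f s) (p := 0) (q := x + 1)
      (hcf.mono Icc_subset_Ici_self) ⟨le_rfl, by linarith⟩ ⟨hx, by linarith⟩
  have hsub : Icc r0 δ ⊆ Ioo (0:ℝ) 1 := fun x hx => ⟨hr0p.trans_le hx.1, hx.2.trans_lt hδ.2⟩
  have hder : ∀ r ∈ Ioo (0:ℝ) 1, HasDerivAt
      (fun r => -(∫ t in (0:ℝ)..(u r), 1 / D.f t) - lam / (10 * α) * Real.log r)
      (-(1 / D.f (u r) * derivWithin u (Icc 0 1) r) - lam / (10 * α) * r⁻¹) r := by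
    intro r hr
    exact ((hII (u r) (h.2.2.1 r ⟨hr.1.le, hr.2⟩)).comp r (u_deriv D h hr)).neg.sub
      ((Real.hasDerivAt_log hr.1.ne').const_mul _)
  have hm := mono_Icc (a := r0) (b := δ)
    (fun x hx => (hder x (hsub hx)).continuousAt.continuousWithinAt)
    (fun x hx => hder x (hsub (Ioo_subset_Icc_self hx)))
    (by
      intro r hr
      have hrI := hsub (Ioo_subset_Icc_self hr)
      have hk := key r hr
      have hF := fu_pos D h (Ioo_subset_Icc_self hrI)
      have hmu := mu_pos D α r
      have hrp := hrI.1
      unfold flux at hk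
      have hk2 : lam * D.f (u r) / (10 * α) ≤ -(r * derivWithin u (Icc 0 1) r) := by
        by_contra hcon
        push Not at hcon
        nlinarith [mul_lt_mul_of_pos_right hcon hmu]
      have : -(1 / D.f (u r) * derivWithin u (Icc 0 1) r) - lam / (10 * α) * r⁻¹
        = (-(r * derivWithin u (Icc 0 1) r) - lam * D.f (u r) / (10 * α)) / (r * D.f (u r)) := by
        field_simp
      rw [this]
      exact div_nonneg (by linarith) (by positivity))
  have hm2 := hm ⟨le_rfl, hr0δ⟩ ⟨hr0δ, le_rfl⟩ hr0δ
  simp only [hlr0] at hm2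
  have hup : ∫ t in (0:ℝ)..(u r0), 1 / D.f t ≤ ∫ s in Ioi (0:ℝ), 1 / D.f s := by
    have hu := (h.2.2.1 r0 ⟨hr0p.le, hr0δ.trans_lt hδ.2⟩).le
    rw [intervalIntegral.integral_of_le hu]
    apply setIntegral_mono_set D.f_int
    · filter_upwards [self_mem_ae_restrict measurableSet_Ioi] with s hs
      exact (one_div_pos.2 (D.f_pos s (le_of_lt hs))).le
    · exact (Ioc_subset_Ioi_self).eventuallyLE
  have hlow : 0 ≤ ∫ t in (0:ℝ)..(u δ), 1 / D.f t := by
    have hu := (h.2.2.1 δ ⟨hδ.1.le, hδ.2⟩).le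
    apply intervalIntegral.integral_nonneg hu
    intro s hs
    exact (one_div_pos.2 (D.f_pos s hs.1)).le
  have hfin : lam / (10 * α) * (Real.log α / 4) ≤ ∫ s in Ioi (0:ℝ), 1 / D.f s := by
    have : 0 ≤ lam / (10 * α) := by positivity
    nlinarith
  have : lam / (10 * α) * (Real.log α / 4) = lam * Real.log α / (40 * α) := by
    field_simp; ring
  rw [this, div_le_iff₀ (by positivity)] at hfin
  linarith

lemma fu_int {α lam : ℝ} {u : ℝ → ℝ} (h : IsSolution D α lam u) {p q : ℝ}
    (hp : 0 ≤ p) (hpq : p ≤ q) (hq : q ≤ 1) :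
    ∫ r in p..q, derivWithin D.f (Ici 0) (u r) * (-derivWithin u (Icc 0 1) r)
      = D.f (u p) - D.f (u q) := by
  have hs : Icc p q ⊆ Icc (0:ℝ) 1 := Icc_subset_Icc hp hq
  have := intervalIntegral.integral_eq_sub_of_hasDerivAt_of_le hpq
    (f := fun r => - D.f (u r))
    (f' := fun r => derivWithin D.f (Ici 0) (u r) * (-derivWithin u (Icc 0 1) r))
    ((fu_cont D h).mono hs).neg
    (fun x hx => ((fu_deriv D h ⟨hp.trans_lt hx.1, hx.2.trans_le hq⟩).neg).congr_deriv (by ring))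
    (ii_of ((fpu_cont D h).mul (v_cont D h).neg) ⟨hp, hpq.trans hq⟩ ⟨hp.trans hpq, hq⟩)
  rw [this]; ring

lemma semistab_cut {α lam : ℝ} {u : ℝ → ℝ} (hl : 0 ≤ lam) (h : IsSolution D α lam u)
    (hss : IsSemistable D α lam u) {r' r0 : ℝ} (h0 : 0 < r') (h1 : r' < r0) (h2 : r0 < 1) :
    lam * ∫ r in (0:ℝ)..r', D.psi r * derivWithin D.f (Ici 0) (u r)
        * (D.f (u r) - D.f (u r')) ^ 2 * muW D α r * r
      ≤ ∫ r in (0:ℝ)..r0, (derivWithin D.f (Ici 0) (u r) * derivWithin u (Icc 0 1) r) ^ 2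
        * muW D α r * r := by
  set χ : ℝ → ℝ := fun s => max 0 (min 1 ((r0 - s) / (r0 - r'))) with hχ
  have hχc : Continuous χ := by
    rw [hχ]
    exact continuous_const.max (continuous_const.min
      ((continuous_const.sub continuous_id).div_const _))
  have hd : 0 < r0 - r' := by linarith
  have hχ0 : ∀ s, 0 ≤ χ s := fun s => le_max_left _ _
  have hχ1 : ∀ s, χ s ≤ 1 := fun s => max_le zero_le_one (min_le_left _ _)
  have hχone : ∀ s, s ≤ r' → χ s = 1 := by
    intro s hs
    have : 1 ≤ (r0 - s) / (r0 - r') := by rw [le_div_iff₀ hd]; linarith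
    simp [hχ, min_eq_left this]
  have hχzero : ∀ s, r0 ≤ s → χ s = 0 := by
    intro s hs
    have : (r0 - s) / (r0 - r') ≤ 0 := div_nonpos_of_nonpos_of_nonneg (by linarith) hd.le
    simp only [hχ]
    exact max_eq_left ((min_le_right _ _).trans this)
  set g : ℝ → ℝ := fun s => derivWithin D.f (Ici 0) (u s) * (-derivWithin u (Icc 0 1) s) * χ s
    with hg
  have hgc : ContinuousOn g (Icc 0 1) :=
    ((fpu_cont D h).mul (v_cont D h).neg).mul hχc.continuousOn
  set gt : ℝ → ℝ := IccExtend (zero_le_one (α := ℝ)) ((Icc (0:ℝ) 1).domRestrict g) with hgt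
  have hgtc : Continuous gt := hgc.domRestrict.Icc_extend'
  have hgteq : ∀ s ∈ Icc (0:ℝ) 1, gt s = g s := fun s hs => by
    rw [hgt, IccExtend_of_mem _ _ hs]; rfl
  have hgn : ∀ s ∈ Icc (0:ℝ) 1, 0 ≤ g s := fun s hs =>
    mul_nonneg (mul_nonneg (fp_nonneg D _) (by have := v_nonpos D hl h hs; linarith)) (hχ0 s)
  set η : ℝ → ℝ := fun r => -∫ s in (1:ℝ)..r, gt s with hη
  have hηd : ∀ r, HasDerivAt η (-gt r) r := fun r =>
    (intervalIntegral.integral_hasDerivAt_right (hgtc.intervalIntegrable _ _)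
      (hgtc.stronglyMeasurableAtFilter _ _) hgtc.continuousAt).neg
  have hηd' : deriv η = fun r => -gt r := funext fun r => (hηd r).deriv
  have hηC : ContDiff ℝ 1 η := contDiff_one_iff_deriv.2
    ⟨fun r => (hηd r).differentiableAt, by rw [hηd']; exact hgtc.neg⟩
  have hηc : Continuous η := hηC.continuous
  have hmain := hss η hηC (by simp [hη])
  have hηlow : ∀ r ∈ Icc 0 r', D.f (u r) - D.f (u r') ≤ η r := by
    intro r hr
    have e1 : η r = ∫ s in r..1, gt s := by
      simp only [hη]; rw [intervalIntegral.integral_symm, neg_neg]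
    have e2 : (∫ s in r..r', gt s) + ∫ s in r'..1, gt s = ∫ s in r..1, gt s :=
      intervalIntegral.integral_add_adjacent_intervals (hgtc.intervalIntegrable _ _)
        (hgtc.intervalIntegrable _ _)
    have e3 : ∫ s in r..r', gt s = D.f (u r) - D.f (u r') := by
      rw [← fu_int D h hr.1 hr.2 (by linarith)]
      apply intervalIntegral.integral_congr
      intro s hs
      rw [uIcc_of_le hr.2] at hs
      simp only
      rw [hgteq s ⟨hr.1.trans hs.1, by linarith [hs.2]⟩, hg]
      simp only
      rw [hχone s hs.2, mul_one]
    have e4 : 0 ≤ ∫ s in r'..1, gt s := by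
      apply intervalIntegral.integral_nonneg (by linarith)
      intro s hs
      have hs' : s ∈ Icc (0:ℝ) 1 := ⟨h0.le.trans hs.1, hs.2⟩
      rw [hgteq s hs']; exact hgn s hs'
    rw [e1, ← e2, e3]; linarith
  -- left side
  have hid : ContinuousOn (fun r : ℝ => r) (Icc 0 1) := continuousOn_id
  have hLc : ContinuousOn (fun r => D.psi r * derivWithin D.f (Ici 0) (u r) * (η r) ^ 2
      * muW D α r * r) (Icc 0 1) :=
    ((((psi_cont D).mul (fpu_cont D h)).mul (hηc.continuousOn.pow 2)).mul (mu_cont D α)).mul hid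
  have hL : ∫ r in (0:ℝ)..r', D.psi r * derivWithin D.f (Ici 0) (u r)
        * (D.f (u r) - D.f (u r')) ^ 2 * muW D α r * r ≤ ∫ r in Ioo (0:ℝ) 1,
        D.psi r * derivWithin D.f (Ici 0) (u r) * (η r) ^ 2 * muW D α r * r := by
    have hr'I : r' ∈ Icc (0:ℝ) 1 := ⟨h0.le, by linarith⟩
    have s1 : ∫ r in (0:ℝ)..r', D.psi r * derivWithin D.f (Ici 0) (u r)
        * (D.f (u r) - D.f (u r')) ^ 2 * muW D α r * r ≤ ∫ r in (0:ℝ)..r',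
        D.psi r * derivWithin D.f (Ici 0) (u r) * (η r) ^ 2 * muW D α r * r := by
      apply intervalIntegral.integral_mono_on h0.le
      · exact ii_of (p := 0) (q := 1) (((((psi_cont D).mul (fpu_cont D h)).mul
          (((fu_cont D h).sub continuousOn_const).pow 2)).mul (mu_cont D α)).mul hid)
          ⟨le_rfl, zero_le_one⟩ hr'I
      · exact ii_of hLc ⟨le_rfl, zero_le_one⟩ hr'I
      · intro r hr
        have hrI : r ∈ Icc (0:ℝ) 1 := ⟨hr.1, hr.2.trans hr'I.2⟩
        have a1 := hηlow r hr
        have a2 : 0 ≤ D.f (u r) - D.f (u r') := sub_nonneg.2 (fu_anti D hl h hrI hr'I hr.2)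
        have a3 := fp_nonneg D (u r)
        have a4 := D.psi_nonneg r hrI
        have a5 := mu_pos D α r
        have a6 := hr.1
        gcongr
    refine s1.trans ?_
    rw [intervalIntegral.integral_of_le h0.le]
    apply setIntegral_mono_set
    · exact hLc.integrableOn_Icc.mono_set Ioo_subset_Icc_self
    · filter_upwards [self_mem_ae_restrict measurableSet_Ioo] with r hr
      have a3 := fp_nonneg D (u r)
      have a4 := D.psi_nonneg r (Ioo_subset_Icc_self hr)
      have a5 := mu_pos D α r
      have a6 := hr.1
      simp only [Pi.zero_apply]
      positivity
    · exact LE.le.eventuallyLE (fun x hx => ⟨hx.1, by linarith [hx.2]⟩)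
  have hR : ∫ r in Ioo (0:ℝ) 1, (deriv η r) ^ 2 * muW D α r * r ≤
      ∫ r in (0:ℝ)..r0, (derivWithin D.f (Ici 0) (u r) * derivWithin u (Icc 0 1) r) ^ 2
        * muW D α r * r := by
    have hr0I : r0 ∈ Icc (0:ℝ) 1 := ⟨by linarith, h2.le⟩
    have hRc : ContinuousOn (fun r => (gt r) ^ 2 * muW D α r * r) (Icc 0 1) :=
      ((hgtc.continuousOn.pow 2).mul (mu_cont D α)).mul hid
    have t1 : ∫ r in Ioo (0:ℝ) 1, (deriv η r) ^ 2 * muW D α r * r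
        = ∫ r in (0:ℝ)..1, (gt r) ^ 2 * muW D α r * r := by
      rw [intervalIntegral.integral_of_le zero_le_one, integral_Ioc_eq_integral_Ioo, hηd']
      simp
    have t2 : (∫ r in (0:ℝ)..r0, (gt r) ^ 2 * muW D α r * r)
        + (∫ r in r0..1, (gt r) ^ 2 * muW D α r * r)
        = ∫ r in (0:ℝ)..1, (gt r) ^ 2 * muW D α r * r :=
      intervalIntegral.integral_add_adjacent_intervals
        (ii_of hRc ⟨le_rfl, zero_le_one⟩ hr0I) (ii_of hRc hr0I ⟨zero_le_one, le_rfl⟩)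
    have t3 : (∫ r in r0..1, (gt r) ^ 2 * muW D α r * r) = 0 := by
      rw [intervalIntegral.integral_congr (g := fun _ => (0:ℝ))]
      · simp
      · intro r hr
        rw [uIcc_of_le h2.le] at hr
        have : gt r = 0 := by
          rw [hgteq r ⟨hr0I.1.trans hr.1, hr.2⟩, hg]
          simp only
          rw [hχzero r hr.1, mul_zero]
        simp [this]
    rw [t1, ← t2, t3, add_zero]
    apply intervalIntegral.integral_mono_on hr0I.1
    · exact ii_of hRc ⟨le_rfl, zero_le_one⟩ hr0I
    · exact ii_of (p := 0) (q := 1) (((((fpu_cont D h).mul (v_cont D h)).pow 2).mul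
        (mu_cont D α)).mul hid) ⟨le_rfl, zero_le_one⟩ hr0I
    · intro r hr
      have hrI : r ∈ Icc (0:ℝ) 1 := ⟨hr.1, hr.2.trans hr0I.2⟩
      have a5 := mu_pos D α r
      have a6 := hr.1
      have : gt r ^ 2 ≤ (derivWithin D.f (Ici 0) (u r) * derivWithin u (Icc 0 1) r) ^ 2 := by
        rw [hgteq r hrI, hg]
        simp only
        rw [mul_pow, mul_neg, neg_sq]
        have := hχ0 r
        have := hχ1 r
        exact mul_le_of_le_one_right (sq_nonneg _) (pow_le_one₀ (hχ0 r) (hχ1 r))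
      gcongr
  exact (mul_le_mul_of_nonneg_left hL hl).trans (hmain.trans hR)

lemma semistab_lim {α lam : ℝ} {u : ℝ → ℝ} (hl : 0 ≤ lam) (h : IsSolution D α lam u)
    (hss : IsSemistable D α lam u) {r0 : ℝ} (h0 : 0 < r0) (h2 : r0 < 1) :
    lam * ∫ r in (0:ℝ)..r0, D.psi r * derivWithin D.f (Ici 0) (u r)
        * (D.f (u r) - D.f (u r0)) ^ 2 * muW D α r * r
      ≤ ∫ r in (0:ℝ)..r0, (derivWithin D.f (Ici 0) (u r) * derivWithin u (Icc 0 1) r) ^ 2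
        * muW D α r * r := by
  have hid : ContinuousOn (fun r : ℝ => r) (Icc 0 1) := continuousOn_id
  set J : ℝ → ℝ := fun r => D.psi r * derivWithin D.f (Ici 0) (u r) * muW D α r * r with hJ
  have hJc : ContinuousOn J (Icc 0 1) :=
    (((psi_cont D).mul (fpu_cont D h)).mul (mu_cont D α)).mul hid
  have hJ1 : ContinuousOn (fun r => J r * D.f (u r)) (Icc 0 1) := hJc.mul (fu_cont D h)
  have hJ2 : ContinuousOn (fun r => J r * D.f (u r) ^ 2) (Icc 0 1) :=
    hJc.mul ((fu_cont D h).pow 2)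
  have hexp : ∀ r' ∈ Icc (0:ℝ) 1, ∫ r in (0:ℝ)..r', D.psi r * derivWithin D.f (Ici 0) (u r)
        * (D.f (u r) - D.f (u r')) ^ 2 * muW D α r * r
      = (∫ r in (0:ℝ)..r', J r * D.f (u r) ^ 2)
        - (2 * D.f (u r')) * (∫ r in (0:ℝ)..r', J r * D.f (u r))
        + (D.f (u r')) ^ 2 * ∫ r in (0:ℝ)..r', J r := by
    intro r' hr'
    have z : (0:ℝ) ∈ Icc (0:ℝ) 1 := ⟨le_rfl, zero_le_one⟩
    rw [← intervalIntegral.integral_const_mul, ← intervalIntegral.integral_const_mul,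
      ← intervalIntegral.integral_sub (ii_of hJ2 z hr') ((ii_of hJ1 z hr').const_mul _),
      ← intervalIntegral.integral_add ((ii_of hJ2 z hr').sub ((ii_of hJ1 z hr').const_mul _))
        ((ii_of hJc z hr').const_mul _)]
    apply intervalIntegral.integral_congr
    intro r _
    simp only [hJ]
    ring
  have hcont : ContinuousOn (fun r' => lam * ∫ r in (0:ℝ)..r',
      D.psi r * derivWithin D.f (Ici 0) (u r)
        * (D.f (u r) - D.f (u r')) ^ 2 * muW D α r * r) (Icc 0 1) := by
    apply continuousOn_const.mul
    refine ContinuousOn.congr ?_ hexp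
    exact ((prim_cont zero_le_one hJ2).sub ((continuousOn_const.mul (fu_cont D h)).mul
      (prim_cont zero_le_one hJ1))).add (((fu_cont D h).pow 2).mul (prim_cont zero_le_one hJc))
  have hcat := (hcont.continuousAt (Icc_mem_nhds h0 h2)).tendsto
  refine le_of_tendsto (hcat.mono_left (nhdsWithin_le_nhds (s := Iio r0))) ?_
  have : Ioo 0 r0 ∈ nhdsWithin r0 (Iio r0) := Ioo_mem_nhdsLT h0
  filter_upwards [this] with r' hr'
  exact semistab_cut D hl h hss hr'.1 hr'.2 h2

lemma energy {α lam : ℝ} {u : ℝ → ℝ} (hl : 0 ≤ lam) (h : IsSolution D α lam u)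
    {r0 : ℝ} (h0 : 0 < r0) (h2 : r0 < 1) :
    ContinuousOn (fun r => ∫ s in (0:ℝ)..(u r - u r0),
          (derivWithin D.f (Ici 0) (u r0 + s)) ^ 2) (Icc 0 r0) ∧
    ∫ r in (0:ℝ)..r0, (derivWithin D.f (Ici 0) (u r) * derivWithin u (Icc 0 1) r) ^ 2
        * muW D α r * r
      = lam * ∫ r in (0:ℝ)..r0, r * muW D α r * D.psi r * D.f (u r) *
        ∫ s in (0:ℝ)..(u r - u r0), (derivWithin D.f (Ici 0) (u r0 + s)) ^ 2 := by
  have hsub : Icc 0 r0 ⊆ Icc (0:ℝ) 1 := Icc_subset_Icc_right h2.le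
  have ha : 0 < u r0 := h.2.2.1 r0 ⟨h0.le, h2⟩
  have hGd : ∀ t, -u r0 < t → HasDerivAt
      (fun t => ∫ s in (0:ℝ)..t, (derivWithin D.f (Ici 0) (u r0 + s)) ^ 2)
      ((derivWithin D.f (Ici 0) (u r0 + t)) ^ 2) t := by
    intro t ht
    refine prim_deriv (g := fun s => (derivWithin D.f (Ici 0) (u r0 + s)) ^ 2)
      (p := -u r0) (q := max 0 t + 1) ?_
      ⟨by linarith, by have := le_max_left 0 t; linarith⟩
      ⟨ht, by have := le_max_right 0 t; linarith⟩
    refine ContinuousOn.pow ((fp_cont D).comp (continuousOn_const.add continuousOn_id) ?_) 2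
    intro s hs
    have := hs.1
    show 0 ≤ _ + s
    linarith
  have hGc : ContinuousOn (fun r => ∫ s in (0:ℝ)..(u r - u r0),
          (derivWithin D.f (Ici 0) (u r0 + s)) ^ 2) (Icc 0 r0) := by
    intro r hr
    have hu : 0 < u r := h.2.2.1 r ⟨hr.1, hr.2.trans_lt h2⟩
    exact (hGd (u r - u r0) (by linarith)).continuousAt.comp_continuousWithinAt
      (f := fun r => u r - u r0)
      (((h.1.continuousOn.mono hsub) r hr).sub continuousWithinAt_const)
  refine ⟨hGc, ?_⟩
  have hid : ContinuousOn (fun r : ℝ => r) (Icc 0 1) := continuousOn_id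
  have c1 : ContinuousOn (fun r => (derivWithin D.f (Ici 0) (u r)
      * derivWithin u (Icc 0 1) r) ^ 2 * muW D α r * r) (Icc 0 r0) :=
    (((((fpu_cont D h).mul (v_cont D h)).pow 2).mul (mu_cont D α)).mul hid).mono hsub
  have c2 : ContinuousOn (fun r => r * muW D α r * D.psi r * D.f (u r) *
        ∫ s in (0:ℝ)..(u r - u r0), (derivWithin D.f (Ici 0) (u r0 + s)) ^ 2) (Icc 0 r0) :=
    ((((hid.mul (mu_cont D α)).mul (psi_cont D)).mul (fu_cont D h)).mono hsub).mul hGc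
  have z : (0:ℝ) ∈ Icc 0 r0 := ⟨le_rfl, h0.le⟩
  have z' : r0 ∈ Icc 0 r0 := ⟨h0.le, le_rfl⟩
  have hftc := intervalIntegral.integral_eq_sub_of_hasDerivAt_of_le h0.le
    (f := fun r => flux D α u r * ∫ s in (0:ℝ)..(u r - u r0),
          (derivWithin D.f (Ici 0) (u r0 + s)) ^ 2)
    (f' := fun r => lam * (r * muW D α r * D.psi r * D.f (u r) *
        ∫ s in (0:ℝ)..(u r - u r0), (derivWithin D.f (Ici 0) (u r0 + s)) ^ 2)
      - (derivWithin D.f (Ici 0) (u r) * derivWithin u (Icc 0 1) r) ^ 2 * muW D α r * r)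
    (((flux_cont D h).mono hsub).mul hGc)
    (by
      intro r hr
      have hrI : r ∈ Ioo (0:ℝ) 1 := ⟨hr.1, hr.2.trans h2⟩
      have hu : 0 < u r := h.2.2.1 r ⟨hr.1.le, hrI.2⟩
      have d1 := (hGd (u r - u r0) (by linarith)).comp r ((u_deriv D h hrI).sub_const (u r0))
      have d2 := (flux_deriv D h hrI).mul d1
      refine HasDerivAt.congr_deriv d2 ?_
      simp only [flux, Function.comp]
      rw [add_sub_cancel]
      ring)
    (((ii_of c2 z z').const_mul _).sub (ii_of c1 z z'))
  rw [intervalIntegral.integral_sub ((ii_of c2 z z').const_mul _) (ii_of c1 z z'),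
    intervalIntegral.integral_const_mul] at hftc
  simp only [flux_zero, sub_self, intervalIntegral.integral_same, mul_zero, zero_mul] at hftc
  linarith

lemma pointwise {c0 c1 a t b : ℝ} (hc0 : c0 ∈ Ioo (0:ℝ) 1) (ha : 0 < a) (ht : 0 ≤ t)
    (hb : a ≤ b) {C1 : ℝ} (hC1 : c1 ≤ C1) (hC2 : 2 ≤ c0 * C1) (hfb : D.f b = C1 * D.f a)
    (hyp : c1 * D.f a ≤ D.f (a + t) →
        (∫ s in (0:ℝ)..t, (derivWithin D.f (Ici 0) (a + s)) ^ 2) ≤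
          (1 - c0) * (D.f (a + t) - D.f a) * derivWithin D.f (Ici 0) (a + t)) :
    derivWithin D.f (Ici 0) b * (c0 / 4 * D.f (a + t) ^ 2 - (C1 + C1 ^ 2) * D.f a ^ 2)
      ≤ derivWithin D.f (Ici 0) (a + t) * (D.f (a + t) - D.f a) ^ 2
        - D.f (a + t) * ∫ s in (0:ℝ)..t, (derivWithin D.f (Ici 0) (a + s)) ^ 2 := by
  have hcs : ContinuousOn (fun s => derivWithin D.f (Ici 0) (a + s)) (Icc 0 t) := by
    refine (fp_cont D).comp (continuousOn_const.add continuousOn_id) ?_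
    intro s hs
    have := hs.1
    show 0 ≤ _ + s
    linarith
  have z : (0:ℝ) ∈ Icc 0 t := ⟨le_rfl, ht⟩
  have z' : t ∈ Icc 0 t := ⟨ht, le_rfl⟩
  have hG : (∫ s in (0:ℝ)..t, (derivWithin D.f (Ici 0) (a + s)) ^ 2) ≤
      (D.f (a + t) - D.f a) * derivWithin D.f (Ici 0) (a + t) := by
    have e1 : ∫ s in (0:ℝ)..t, derivWithin D.f (Ici 0) (a + s) = D.f (a + t) - D.f a := by
      have := intervalIntegral.integral_eq_sub_of_hasDerivAt_of_le ht
        (f := fun s => D.f (a + s)) (f' := fun s => derivWithin D.f (Ici 0) (a + s))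
        (by
          refine (f_cont D).comp (continuousOn_const.add continuousOn_id) ?_
          intro s hs
          have := hs.1
          show 0 ≤ _ + s
          linarith)
        (fun s hs => by
          have := (f_deriv D (x := a + s) (by linarith [hs.1])).comp s
            ((hasDerivAt_id s).const_add a)
          exact this.congr_deriv (by ring))
        (ii_of hcs z z')
      simpa using this
    rw [← e1, ← intervalIntegral.integral_mul_const]
    apply intervalIntegral.integral_mono_on ht
    · exact ii_of (hcs.pow 2) z z'
    · exact ii_of (hcs.mul continuousOn_const) z z'
    · intro s hs
      have m : derivWithin D.f (Ici 0) (a + s) ≤ derivWithin D.f (Ici 0) (a + t) :=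
        fp_mono D (by simp only [mem_Ici]; linarith [hs.1]) (by simp only [mem_Ici]; linarith)
          (by linarith [hs.2])
      have := fp_nonneg D (a + s)
      nlinarith
  have hFa := D.f_pos a ha.le
  have hF : D.f a ≤ D.f (a + t) :=
    D.f_mono (by simp only [mem_Ici]; linarith) (by simp only [mem_Ici]; linarith) (by linarith)
  have hc00 := hc0.1
  have hc01 := hc0.2
  have hC1p : 2 ≤ C1 := by nlinarith
  have hp := fp_nonneg D (a + t)
  have hpb := fp_nonneg D b
  generalize (∫ s in (0:ℝ)..t, (derivWithin D.f (Ici 0) (a + s)) ^ 2) = G at *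
  rcases le_total b (a + t) with hc | hc
  · have hFb : C1 * D.f a ≤ D.f (a + t) := by
      rw [← hfb]
      exact D.f_mono (by simp only [mem_Ici]; linarith) (by simp only [mem_Ici]; linarith) hc
    have hpm : derivWithin D.f (Ici 0) b ≤ derivWithin D.f (Ici 0) (a + t) :=
      fp_mono D (by simp only [mem_Ici]; linarith) (by simp only [mem_Ici]; linarith) hc
    have hy := hyp (by nlinarith)
    generalize D.f (a + t) = F at *
    generalize D.f a = A at *
    generalize derivWithin D.f (Ici 0) (a + t) = p at *
    generalize derivWithin D.f (Ici 0) b = q at *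
    have k1 : F * G ≤ F * ((1 - c0) * (F - A) * p) := mul_le_mul_of_nonneg_left hy (by linarith)
    have k2 : F / 2 ≤ F - A := by nlinarith
    have k3 : c0 * F / 2 ≤ c0 * F - A := by nlinarith
    have k4 : (F / 2) * (c0 * F / 2) ≤ (F - A) * (c0 * F - A) :=
      mul_le_mul k2 k3 (by have : 0 < F := by linarith
                           positivity) (by linarith)
    have k5 : q * ((F / 2) * (c0 * F / 2)) ≤ p * ((F - A) * (c0 * F - A)) :=
      mul_le_mul hpm k4 (by have : 0 < F := by linarith
                            positivity) hp
    have k6 : 0 ≤ q * ((C1 + C1 ^ 2) * A ^ 2) := by positivity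
    nlinarith
  · have hFb : D.f (a + t) ≤ C1 * D.f a := by
      rw [← hfb]
      exact D.f_mono (by simp only [mem_Ici]; linarith) (by simp only [mem_Ici]; linarith) hc
    have hpm : derivWithin D.f (Ici 0) (a + t) ≤ derivWithin D.f (Ici 0) b :=
      fp_mono D (by simp only [mem_Ici]; linarith) (by simp only [mem_Ici]; linarith) hc
    clear hyp
    generalize D.f (a + t) = F at *
    generalize D.f a = A at *
    generalize derivWithin D.f (Ici 0) (a + t) = p at *
    generalize derivWithin D.f (Ici 0) b = q at *
    have k1 : F * G ≤ F * ((F - A) * p) := mul_le_mul_of_nonneg_left hG (by linarith)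
    have k2 : p * ((F - A) * A) ≤ q * ((C1 * A) * A) :=
      mul_le_mul hpm (mul_le_mul_of_nonneg_right (by linarith) hFa.le)
        (mul_nonneg (by linarith) hFa.le) hpb
    have k3 : c0 / 4 * F ^ 2 ≤ C1 ^ 2 * A ^ 2 := by
      have : F ^ 2 ≤ (C1 * A) ^ 2 := pow_le_pow_left₀ (by linarith) hFb 2
      have := sq_nonneg F
      nlinarith
    have k4 := mul_le_mul_of_nonneg_left k3 hpb
    nlinarith

lemma main_est {c0 c1 α lam : ℝ} {u : ℝ → ℝ} (hc0 : c0 ∈ Ioo (0:ℝ) 1) (hα : 0 < α)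
    (hl : 0 ≤ lam) (h : IsSolution D α lam u)
    (hss : IsSemistable D α lam u) {r0 : ℝ} (h0 : 0 < r0) (h2 : r0 < 1) (hαr : α * r0 ^ 2 = 1)
    {C1 : ℝ} (hC1 : c1 ≤ C1) (hC2 : 2 ≤ c0 * C1)
    (hyp : ∀ t ≥ (0:ℝ), c1 * D.f (u r0) ≤ D.f (u r0 + t) →
        (∫ s in (0:ℝ)..t, (derivWithin D.f (Ici 0) (u r0 + s)) ^ 2) ≤
          (1 - c0) * (D.f (u r0 + t) - D.f (u r0)) * derivWithin D.f (Ici 0) (u r0 + t)) :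
    lam * ∫ r in (0:ℝ)..r0, r * muW D α r * D.psi r * D.f (u r) ^ 2
      ≤ lam * (4 / c0 * (C1 + C1 ^ 2) * D.f (u r0) ^ 2 * r0 ^ 2) := by
  have hsub : Icc 0 r0 ⊆ Icc (0:ℝ) 1 := Icc_subset_Icc_right h2.le
  have hr0I : r0 ∈ Icc (0:ℝ) 1 := ⟨h0.le, h2.le⟩
  have ha : 0 < u r0 := h.2.2.1 r0 ⟨h0.le, h2⟩
  have hA := D.f_pos _ ha.le
  have hid : ContinuousOn (fun r : ℝ => r) (Icc 0 1) := continuousOn_id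
  have hWc : ContinuousOn (fun r => r * muW D α r * D.psi r) (Icc 0 r0) :=
    ((hid.mul (mu_cont D α)).mul (psi_cont D)).mono hsub
  have hFc := (fu_cont D h).mono hsub
  have hW2c : ContinuousOn (fun r => r * muW D α r * D.psi r * D.f (u r) ^ 2) (Icc 0 r0) :=
    hWc.mul (hFc.pow 2)
  have hWn : ∀ r ∈ Icc 0 r0, 0 ≤ r * muW D α r * D.psi r := fun r hr =>
    mul_nonneg (mul_nonneg hr.1 (mu_pos D α r).le) (D.psi_nonneg r (hsub hr))
  have hWle : ∀ r ∈ Icc 0 r0, r * muW D α r * D.psi r ≤ 2 * r := by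
    intro r hr
    have m1 := mu_le D hα.le (hsub hr)
      (by rw [← hαr]; have := hr.1; have := hr.2; gcongr)
    have m2 := psi_le_one D (hsub hr)
    have m3 := D.psi_nonneg r (hsub hr)
    have m4 := mu_pos D α r
    have : muW D α r * D.psi r ≤ 2 := by nlinarith
    nlinarith [hr.1]
  have z : (0:ℝ) ∈ Icc 0 r0 := ⟨le_rfl, h0.le⟩
  have z' : r0 ∈ Icc 0 r0 := ⟨h0.le, le_rfl⟩
  have hWint : ∫ r in (0:ℝ)..r0, r * muW D α r * D.psi r ≤ r0 ^ 2 := by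
    have : ∫ r in (0:ℝ)..r0, r * muW D α r * D.psi r ≤ ∫ r in (0:ℝ)..r0, 2 * r :=
      intervalIntegral.integral_mono_on h0.le (ii_of hWc z z')
        ((continuous_const.mul continuous_id).intervalIntegrable _ _) hWle
    rw [intervalIntegral.integral_const_mul, integral_id] at this
    linarith
  have hc00 := hc0.1
  have hC1p : 2 ≤ C1 := by nlinarith [hc0.2]
  rcases le_or_gt (D.f (u 0)) (C1 * D.f (u r0)) with hcase | hcase
  · -- trivial case
    apply mul_le_mul_of_nonneg_left _ hl
    have s1 : ∫ r in (0:ℝ)..r0, r * muW D α r * D.psi r * D.f (u r) ^ 2 ≤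
        ∫ r in (0:ℝ)..r0, r * muW D α r * D.psi r * (C1 * D.f (u r0)) ^ 2 := by
      apply intervalIntegral.integral_mono_on h0.le (ii_of hW2c z z')
        (ii_of (hWc.mul continuousOn_const) z z')
      intro r hr
      have b1 : D.f (u r) ≤ C1 * D.f (u r0) :=
        (fu_anti D hl h ⟨le_rfl, zero_le_one⟩ (hsub hr) hr.1).trans hcase
      have b2 := fu_pos D h (hsub hr)
      have b3 := hWn r hr
      exact mul_le_mul_of_nonneg_left (pow_le_pow_left₀ b2.le b1 2) b3
    rw [intervalIntegral.integral_mul_const] at s1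
    refine s1.trans ?_
    have e1 : (∫ r in (0:ℝ)..r0, r * muW D α r * D.psi r) * (C1 * D.f (u r0)) ^ 2
        ≤ r0 ^ 2 * (C1 * D.f (u r0)) ^ 2 := mul_le_mul_of_nonneg_right hWint (sq_nonneg _)
    have e2 : 1 ≤ 4 / c0 := by rw [le_div_iff₀ hc00]; linarith [hc0.2]
    have e3 : C1 ^ 2 ≤ 4 / c0 * (C1 + C1 ^ 2) := by nlinarith
    have e4 := mul_le_mul_of_nonneg_right e3 (mul_nonneg (sq_nonneg (D.f (u r0))) (sq_nonneg r0))
    nlinarith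
  · -- main case
    have hu0 : u r0 ≤ u 0 := u_anti D hl h ⟨le_rfl, zero_le_one⟩ hr0I h0.le
    obtain ⟨b, hbI, hfb⟩ : C1 * D.f (u r0) ∈ D.f '' Icc (u r0) (u 0) := by
      apply intermediate_value_Icc hu0
        ((f_cont D).mono (fun x hx => ha.le.trans hx.1))
      exact ⟨by nlinarith, hcase.le⟩
    have hq : 0 < derivWithin D.f (Ici 0) b := by
      have hab : u r0 < b := by
        rcases hbI.1.lt_or_eq with hh | hh
        · exact hh
        · rw [← hh] at hfb; nlinarith
      obtain ⟨ξ, hξ, hξe⟩ := exists_hasDerivAt_eq_slope D.f (derivWithin D.f (Ici 0)) hab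
        ((f_cont D).mono (fun x hx => ha.le.trans hx.1))
        (fun x hx => f_deriv D (ha.trans hx.1))
      have p1 : 0 < derivWithin D.f (Ici 0) ξ := by
        rw [hξe, hfb]
        apply div_pos <;> nlinarith
      exact p1.trans_le (fp_mono D (by simp only [mem_Ici]; linarith [hξ.1])
        (by simp only [mem_Ici]; linarith) hξ.2.le)
    obtain ⟨hGc, hen⟩ := energy D hl h h0 h2
    have hst := semistab_lim D hl h hss h0 h2
    rw [hen] at hst
    have hAc : ContinuousOn (fun r => D.psi r * derivWithin D.f (Ici 0) (u r)
        * (D.f (u r) - D.f (u r0)) ^ 2 * muW D α r * r) (Icc 0 r0) :=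
      (((((psi_cont D).mul (fpu_cont D h)).mul
          (((fu_cont D h).sub continuousOn_const).pow 2)).mul (mu_cont D α)).mul hid).mono hsub
    have hBc : ContinuousOn (fun r => r * muW D α r * D.psi r * D.f (u r) *
        ∫ s in (0:ℝ)..(u r - u r0), (derivWithin D.f (Ici 0) (u r0 + s)) ^ 2) (Icc 0 r0) :=
      (hWc.mul hFc).mul hGc
    have hint : ∫ r in (0:ℝ)..r0, derivWithin D.f (Ici 0) b * (c0 / 4 *
          (r * muW D α r * D.psi r * D.f (u r) ^ 2)
          - (C1 + C1 ^ 2) * D.f (u r0) ^ 2 * (r * muW D α r * D.psi r))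
        ≤ ∫ r in (0:ℝ)..r0, (D.psi r * derivWithin D.f (Ici 0) (u r)
        * (D.f (u r) - D.f (u r0)) ^ 2 * muW D α r * r - r * muW D α r * D.psi r * D.f (u r) *
        ∫ s in (0:ℝ)..(u r - u r0), (derivWithin D.f (Ici 0) (u r0 + s)) ^ 2) := by
      apply intervalIntegral.integral_mono_on h0.le
      · exact ii_of (continuousOn_const.mul ((continuousOn_const.mul hW2c).sub
          (continuousOn_const.mul hWc))) z z'
      · exact ii_of (hAc.sub hBc) z z'
      · intro r hr
        have hru : u r0 ≤ u r := u_anti D hl h (hsub hr) hr0I hr.2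
        have hpt := pointwise D hc0 ha (t := u r - u r0) (by linarith) hbI.1 hC1 hC2 hfb
          (hyp _ (by simp only [ge_iff_le]; linarith))
        rw [add_sub_cancel] at hpt
        have := mul_le_mul_of_nonneg_left hpt (hWn r hr)
        linarith
    rw [intervalIntegral.integral_const_mul,
      intervalIntegral.integral_sub ((ii_of hW2c z z').const_mul _)
        ((ii_of hWc z z').const_mul _),
      intervalIntegral.integral_sub (ii_of hAc z z') (ii_of hBc z z'),
      intervalIntegral.integral_const_mul, intervalIntegral.integral_const_mul] at hint
    have hint2 := mul_le_mul_of_nonneg_left hint hl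
    generalize (∫ r in (0:ℝ)..r0, r * muW D α r * D.psi r * D.f (u r) *
        ∫ s in (0:ℝ)..(u r - u r0), (derivWithin D.f (Ici 0) (u r0 + s)) ^ 2) = I1 at *
    generalize (∫ r in (0:ℝ)..r0, D.psi r * derivWithin D.f (Ici 0) (u r)
        * (D.f (u r) - D.f (u r0)) ^ 2 * muW D α r * r) = I2 at *
    generalize (∫ r in (0:ℝ)..r0, r * muW D α r * D.psi r * D.f (u r) ^ 2) = I3 at *
    generalize (∫ r in (0:ℝ)..r0, r * muW D α r * D.psi r) = I4 at *
    generalize derivWithin D.f (Ici 0) b = q at *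
    generalize D.f (u r0) = A at *
    have f1 : q * (lam * (c0 / 4 * I3 - (C1 + C1 ^ 2) * A ^ 2 * I4)) ≤ 0 := by nlinarith
    have f2 : lam * (c0 / 4 * I3 - (C1 + C1 ^ 2) * A ^ 2 * I4) ≤ 0 := by
      by_contra hcon
      push Not at hcon
      nlinarith [mul_pos hq hcon]
    have f3 : lam * ((C1 + C1 ^ 2) * A ^ 2 * I4) ≤ lam * ((C1 + C1 ^ 2) * A ^ 2 * r0 ^ 2) := by
      have : 0 ≤ (C1 + C1 ^ 2) * A ^ 2 := by positivity
      gcongr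
    have f4 : c0 / 4 * (lam * I3) ≤ lam * ((C1 + C1 ^ 2) * A ^ 2 * r0 ^ 2) := by linarith
    have f5 : lam * (4 / c0 * (C1 + C1 ^ 2) * A ^ 2 * r0 ^ 2)
        = lam * ((C1 + C1 ^ 2) * A ^ 2 * r0 ^ 2) * 4 / c0 := by ring
    rw [f5, le_div_iff₀ hc00]
    linarith

lemma center_est {α lam : ℝ} {u : ℝ → ℝ} (hα : 0 < α)
    (hl : 0 ≤ lam) (h : IsSolution D α lam u)
    {r0 : ℝ} (h0 : 0 < r0) (h2 : r0 < 1) (hαr : α * r0 ^ 2 = 1) {C : ℝ}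
    (hC : lam * ∫ r in (0:ℝ)..r0, r * muW D α r * D.psi r * D.f (u r) ^ 2
      ≤ lam * (C * D.f (u r0) ^ 2 * r0 ^ 2)) :
    u 0 ≤ u r0 + lam * ((C + 1) / 2 * D.f (u r0) * r0 ^ 2) := by
  have hsub : Icc 0 r0 ⊆ Icc (0:ℝ) 1 := Icc_subset_Icc_right h2.le
  have hr0I : r0 ∈ Icc (0:ℝ) 1 := ⟨h0.le, h2.le⟩
  have hA := fu_pos D h hr0I
  have hid : ContinuousOn (fun r : ℝ => r) (Icc 0 1) := continuousOn_id
  have hWc : ContinuousOn (fun r => r * muW D α r * D.psi r) (Icc 0 r0) :=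
    ((hid.mul (mu_cont D α)).mul (psi_cont D)).mono hsub
  have hFc := (fu_cont D h).mono hsub
  have hW1c : ContinuousOn (fun r => r * muW D α r * D.psi r * D.f (u r)) (Icc 0 r0) :=
    hWc.mul hFc
  have hW2c : ContinuousOn (fun r => r * muW D α r * D.psi r * D.f (u r) ^ 2) (Icc 0 r0) :=
    hWc.mul (hFc.pow 2)
  have hWn : ∀ r ∈ Icc 0 r0, 0 ≤ r * muW D α r * D.psi r := fun r hr =>
    mul_nonneg (mul_nonneg hr.1 (mu_pos D α r).le) (D.psi_nonneg r (hsub hr))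
  have hWle : ∀ r ∈ Icc 0 r0, r * muW D α r * D.psi r ≤ 2 * r := by
    intro r hr
    have m1 := mu_le D hα.le (hsub hr)
      (by rw [← hαr]; have := hr.1; have := hr.2; gcongr)
    have m2 := psi_le_one D (hsub hr)
    have m3 := D.psi_nonneg r (hsub hr)
    have m4 := mu_pos D α r
    have : muW D α r * D.psi r ≤ 2 := by nlinarith
    nlinarith [hr.1]
  have z : (0:ℝ) ∈ Icc 0 r0 := ⟨le_rfl, h0.le⟩
  have z' : r0 ∈ Icc 0 r0 := ⟨h0.le, le_rfl⟩
  set A := D.f (u r0) with hAdef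
  have hflux : ∀ r ∈ Ioo 0 r0, flux D α u r ≤ lam * ((C + 1) / 2 * A * r0) * r := by
    intro r hr
    have hrI : r ∈ Icc 0 r0 := Ioo_subset_Icc_self hr
    have hsub2 : Icc 0 r ⊆ Icc 0 r0 := Icc_subset_Icc_right hr.2.le
    have hrp := hr.1
    have e1 := intervalIntegral.integral_eq_sub_of_hasDerivAt_of_le hr.1.le
      (f := flux D α u)
      (f' := fun r => lam * (r * muW D α r * D.psi r * D.f (u r)))
      ((flux_cont D h).mono (hsub2.trans hsub))
      (fun x hx => flux_deriv D h ⟨hx.1, by linarith [hx.2, hr.2]⟩)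
      (ii_of (continuousOn_const.mul hW1c) z hrI)
    rw [flux_zero, sub_zero, intervalIntegral.integral_const_mul] at e1
    have e2 : ∫ s in (0:ℝ)..r, s * muW D α s * D.psi s * D.f (u s) ≤
        ∫ s in (0:ℝ)..r, (r / (2 * r0 * A) * (s * muW D α s * D.psi s * D.f (u s) ^ 2)
          + A * r0 / (2 * r) * (s * muW D α s * D.psi s)) := by
      apply intervalIntegral.integral_mono_on hr.1.le (ii_of hW1c z hrI)
        (((ii_of hW2c z hrI).const_mul _).add ((ii_of hWc z hrI).const_mul _))
      intro s hs
      have hw := hWn s (hsub2 hs)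
      have am : D.f (u s) ≤ r / (2 * r0 * A) * D.f (u s) ^ 2 + A * r0 / (2 * r) := by
        have : r / (2 * r0 * A) * D.f (u s) ^ 2 + A * r0 / (2 * r) - D.f (u s)
          = (r * D.f (u s) - A * r0) ^ 2 / (2 * r0 * A * r) := by
          field_simp
          ring
        have : 0 ≤ (r * D.f (u s) - A * r0) ^ 2 / (2 * r0 * A * r) := by positivity
        linarith
      have := mul_le_mul_of_nonneg_left am hw
      show _ ≤ r / (2 * r0 * A) * (s * muW D α s * D.psi s * D.f (u s) ^ 2)
          + A * r0 / (2 * r) * (s * muW D α s * D.psi s)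
      linarith
    rw [intervalIntegral.integral_add ((ii_of hW2c z hrI).const_mul _)
      ((ii_of hWc z hrI).const_mul _), intervalIntegral.integral_const_mul,
      intervalIntegral.integral_const_mul] at e2
    have e3 : ∫ s in (0:ℝ)..r, s * muW D α s * D.psi s * D.f (u s) ^ 2 ≤
        ∫ s in (0:ℝ)..r0, s * muW D α s * D.psi s * D.f (u s) ^ 2 := by
      rw [← intervalIntegral.integral_add_adjacent_intervals (ii_of hW2c z hrI)
        (ii_of hW2c hrI z')]
      have : 0 ≤ ∫ s in r..r0, s * muW D α s * D.psi s * D.f (u s) ^ 2 :=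
        intervalIntegral.integral_nonneg hr.2.le (fun s hs =>
          mul_nonneg (hWn s ⟨hr.1.le.trans hs.1, hs.2⟩) (sq_nonneg _))
      linarith
    have e4 : ∫ s in (0:ℝ)..r, s * muW D α s * D.psi s ≤ r ^ 2 := by
      have : ∫ s in (0:ℝ)..r, s * muW D α s * D.psi s ≤ ∫ s in (0:ℝ)..r, 2 * s :=
        intervalIntegral.integral_mono_on hr.1.le (ii_of hWc z hrI)
          ((continuous_const.mul continuous_id).intervalIntegrable _ _)
          (fun s hs => hWle s (hsub2 hs))
      rw [intervalIntegral.integral_const_mul, integral_id] at this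
      linarith
    rw [← e1]
    have p1 : 0 ≤ r / (2 * r0 * A) := by positivity
    have p2 : 0 ≤ A * r0 / (2 * r) := by positivity
    have e5 := mul_le_mul_of_nonneg_left (e2.trans (add_le_add
      (mul_le_mul_of_nonneg_left e3 p1) (mul_le_mul_of_nonneg_left e4 p2))) hl
    have e6 := mul_le_mul_of_nonneg_left hC p1
    refine e5.trans ?_
    have e7 : r / (2 * r0 * A) * (lam * (C * A ^ 2 * r0 ^ 2)) + lam * (A * r0 / (2 * r) * r ^ 2)
        = lam * ((C + 1) / 2 * A * r0) * r := by
      field_simp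
    linarith
  have hm := mono_Icc (a := 0) (b := r0)
    (g := fun r => u r + lam * ((C + 1) / 2 * A * r0) * r)
    (g' := fun r => derivWithin u (Icc 0 1) r + lam * ((C + 1) / 2 * A * r0) * 1)
    ((h.1.continuousOn.mono hsub).add (continuousOn_const.mul continuousOn_id))
    (fun x hx => (u_deriv D h ⟨hx.1, hx.2.trans h2⟩).add ((hasDerivAt_id x).const_mul _))
    (by
      intro r hr
      have hf := hflux r hr
      unfold flux at hf
      have hmu := mu_ge_one D hα.le (hsub (Ioo_subset_Icc_self hr))
      have hv := v_nonpos D hl h (hsub (Ioo_subset_Icc_self hr))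
      have hrp := hr.1
      generalize derivWithin u (Icc 0 1) r = v at *
      generalize lam * ((C + 1) / 2 * A * r0) = k at *
      have : r * (-v) ≤ r * k := by
        nlinarith [mul_nonneg (mul_nonneg hrp.le (neg_nonneg.2 hv)) (sub_nonneg.2 hmu)]
      have := le_of_mul_le_mul_left this hrp
      linarith)
  have := hm z z' h0.le
  simp only [mul_zero, add_zero] at this
  nlinarith

end

/-- Fix `c̃₀ ∈ (0,1)` and `c̃₁ > 1`. There are `c > 0` and `α₀`
such that for all `α ≥ α₀`: if `u` is a semistable solution of `(P_{α,λ*(α)})` and,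
with `a = u(1/√α)`, the implication
`f(a+t) ≥ c̃₁ f(a) ⟹ (1 - c̃₀)(f(a+t) - f(a)) f'(a+t) ≥ ∫₀^t f'(a+s)² ds`
holds for all `t ≥ 0`, then `u(0) ≤ a + c f(a)/log α`. -/
theorem extremal_center_bound (D : GelfandData) (c0 c1 : ℝ)
    (hc0 : c0 ∈ Ioo (0:ℝ) 1) (hc1 : 1 < c1) :
    ∃ c > (0:ℝ), ∃ α₀ : ℝ, ∀ α ≥ α₀, ∀ u : ℝ → ℝ,
      IsSolution D α (lamStar D α) u → IsSemistable D α (lamStar D α) u →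
      (∀ t ≥ (0:ℝ), c1 * D.f (u (1 / Real.sqrt α)) ≤ D.f (u (1 / Real.sqrt α) + t) →
        (∫ s in (0:ℝ)..t, (derivWithin D.f (Ici 0) (u (1 / Real.sqrt α) + s)) ^ 2) ≤
          (1 - c0) * (D.f (u (1 / Real.sqrt α) + t) - D.f (u (1 / Real.sqrt α)))
            * derivWithin D.f (Ici 0) (u (1 / Real.sqrt α) + t)) →
      u 0 ≤ u (1 / Real.sqrt α) + c * D.f (u (1 / Real.sqrt α)) / Real.log α := by
  obtain ⟨K, hK, α₀, hα₀, hlam⟩ := lam_bound D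
  set C1 := max c1 (2 / c0) with hC1
  have hc00 := hc0.1
  have hC2 : 2 ≤ c0 * C1 := by
    have := le_max_right c1 (2 / c0)
    rw [div_le_iff₀ hc00] at this
    linarith
  have hC1p : 0 < C1 := lt_of_lt_of_le (by linarith) (le_max_left c1 (2 / c0))
  set C := 4 / c0 * (C1 + C1 ^ 2) with hC
  have hCp : 0 < C := by positivity
  refine ⟨(C + 1) / 2 * K + 1, by positivity, α₀, ?_⟩
  intro α hα u hu hss hyp
  have hα1 : 1 < α := lt_of_lt_of_le hα₀ hα
  have hα0 : 0 < α := by linarith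
  have hl : 0 ≤ lamStar D α := Real.sSup_nonneg (fun x hx => hx.1.le)
  have hlb := hlam α hα _ hl u hu
  have hsq : 1 < Real.sqrt α := by rw [Real.lt_sqrt] <;> linarith
  set r0 := 1 / Real.sqrt α with hr0
  have h0 : 0 < r0 := by positivity
  have h2 : r0 < 1 := by rw [hr0, div_lt_one (by linarith)]; exact hsq
  have hr0sq : α * r0 ^ 2 = 1 := by
    rw [hr0, div_pow, Real.sq_sqrt hα0.le]; field_simp
  have hr2 : r0 ^ 2 = 1 / α := by field_simp; linarith
  have hm := main_est D hc0 hα0 hl hu hss h0 h2 hr0sq (le_max_left c1 (2 / c0)) hC2 hyp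
  have hce := center_est D hα0 hl hu h0 h2 hr0sq hm
  have hA := fu_pos D hu ⟨h0.le, h2.le⟩
  have hlog : 0 < Real.log α := Real.log_pos hα1
  have hl2 : lamStar D α * r0 ^ 2 ≤ K / Real.log α := by
    rw [hr2, le_div_iff₀ hlog, mul_one_div, div_mul_eq_mul_div, div_le_iff₀ hα0]
    exact hlb
  have hp : 0 ≤ (C + 1) / 2 * D.f (u r0) := by positivity
  have h3 := mul_le_mul_of_nonneg_left hl2 hp
  have h4 : ((C + 1) / 2 * K + 1) * D.f (u r0) / Real.log α
      = (C + 1) / 2 * D.f (u r0) * (K / Real.log α) + D.f (u r0) / Real.log α := by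
    field_simp
  have h5 : 0 < D.f (u r0) / Real.log α := div_pos hA hlog
  rw [h4]
  linarith
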